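/- The atomicity/controlled-invocation finite state machine of VRASED satisfies the secure-reset LTL Specification (10): for every input trace, the run of the five-state FSM (defined in the context) satisfies G: { reset → (reset U PC = 0) ∨ G(reset) }, i.e., once the reset output is raised it stays raised until a state in which PC = 0 is reached, or forever. -/

import Mathlib

/-- States of the atomicity/controlled-invocation FSM of VRASED. -/
inductive S5 where
  | notCR : S5
  | fstCR : S5
  | midCR : S5
  | lstCR : S5
  | Reset : S5
deriving DecidableEq

-- Transition function of the atomicity/controlled-invocation FSM, on inputs (PC, irq).
open Classical in
noncomputable def atomDelta (CRmin CRmax : ℕ) (PC : ℕ → ℕ) (irq : ℕ → Prop) :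
    S5 → ℕ → S5
  | S5.notCR, t =>
      if PC t < CRmin ∨ PC t > CRmax then S5.notCR
      else if PC t = CRmin ∧ ¬ irq t then S5.fstCR
      else S5.Reset
  | S5.fstCR, t =>
      if PC t = CRmin ∧ ¬ irq t then S5.fstCR
      else if (CRmin < PC t ∧ PC t < CRmax) ∧ ¬ irq t then S5.midCR
      else S5.Reset
  | S5.midCR, t =>
      if (CRmin < PC t ∧ PC t < CRmax) ∧ ¬ irq t then S5.midCR
      else if PC t = CRmax ∧ ¬ irq t then S5.lstCR
      else S5.Reset
  | S5.lstCR, t =>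
      if PC t = CRmax ∧ ¬ irq t then S5.lstCR
      else if (PC t < CRmin ∨ PC t > CRmax) ∧ ¬ irq t then S5.notCR
      else S5.Reset
  | S5.Reset, t =>
      if PC t = 0 then S5.notCR
      else S5.Reset


theorem reset_of_forall_ne_zero {CRmin CRmax : ℕ} {PC : ℕ → ℕ} {irq : ℕ → Prop} {s : ℕ → S5}
    (hstep : ∀ t : ℕ, s (t + 1) = atomDelta CRmin CRmax PC irq (s t) (t + 1))
    {t u : ℕ} (ht : s t = S5.Reset) (htu : t ≤ u)
    (hPC : ∀ v, t < v → v ≤ u → PC v ≠ 0) : s u = S5.Reset := by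
  induction u, htu using Nat.le_induction with
  | base => exact ht
  | succ u htu ih =>
    rw [hstep u, ih fun v hv hvu => hPC v hv (by lia)]
    exact if_neg (hPC (u + 1) (by lia) le_rfl)

/-- the atomicity/controlled-invocation FSM of VRASED satisfies the
secure-reset LTL Specification (10): for every input trace, at every time,
reset → (reset U PC = 0) ∨ G(reset), where reset(t) := (s(t) = Reset). -/
theorem atomicity_fsm_satisfies_secure_reset
    (CRmin CRmax : ℕ)
    (hCR : 0 < CRmin ∧ CRmin < CRmax)
    (PC : ℕ → ℕ)
    (irq : ℕ → Prop)
    (s : ℕ → S5)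
    (hs0 : s 0 = S5.Reset)
    (hstep : ∀ t : ℕ, s (t + 1) = atomDelta CRmin CRmax PC irq (s t) (t + 1)) :
    ∀ t : ℕ, s t = S5.Reset →
      ((∃ t', t ≤ t' ∧ PC t' = 0 ∧ ∀ u, t ≤ u → u < t' → s u = S5.Reset) ∨
       (∀ u, t ≤ u → s u = S5.Reset)) := by
  classical
  intro t ht
  by_cases h : ∃ t', t ≤ t' ∧ PC t' = 0
  · refine Or.inl ⟨Nat.find h, (Nat.find_spec h).1, (Nat.find_spec h).2, fun u htu hu => ?_⟩
    exact reset_of_forall_ne_zero hstep ht htu fun v htv hvu hv =>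
      Nat.find_min h (hvu.trans_lt hu) ⟨htv.le, hv⟩
  · exact Or.inr fun u htu => reset_of_forall_ne_zero hstep ht htu fun v htv _ hv =>
      h ⟨v, htv.le, hv⟩
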